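/- The double series ∑_{m=0}^∞ ∑_{n=0}^∞ C(2m,m)² · C(2n,n)² / (16^{m+n} · (m+n+1) · (2m+3)) equals (7ζ(3) - 4G)/π². -/

import Mathlib

open Real

/-- Catalan's constant `G = ∑_{n=0}^∞ (-1)^n/(2n+1)²`. -/
noncomputable def catalanG : ℝ := ∑' n : ℕ, (-1) ^ n / (2 * (n:ℝ) + 1)^2

/-- Apéry's constant `ζ(3) = ∑_{k=1}^∞ 1/k³`. -/
noncomputable def zeta3 : ℝ := ∑' k : ℕ, 1 / ((k:ℝ) + 1)^3

open Filter Topology Finset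

/-- The squared normalised central binomial coefficient `C(2n,n)² / 16ⁿ`. -/
noncomputable def sqCentral (n : ℕ) : ℝ := ((2 * n).choose n : ℝ) ^ 2 / 16 ^ n

lemma sqCentral_zero : sqCentral 0 = 1 := by simp [sqCentral]

lemma sqCentral_pos (n : ℕ) : 0 < sqCentral n := by
  have : 0 < (2 * n).choose n := Nat.choose_pos (by omega)
  unfold sqCentral
  positivity

lemma sqCentral_succ (n : ℕ) :
    ((n : ℝ) + 1) ^ 2 * sqCentral (n + 1) = ((n : ℝ) + 1 / 2) ^ 2 * sqCentral n := by
  have h : ((n : ℝ) + 1) * ((2 * (n + 1)).choose (n + 1) : ℝ)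
      = 2 * (2 * n + 1) * ((2 * n).choose n : ℝ) := by
    have := Nat.succ_mul_centralBinom_succ n
    simp only [Nat.centralBinom] at this
    exact_mod_cast this
  have h2 := congrArg (fun x : ℝ => x ^ 2) h
  simp only [mul_pow] at h2
  unfold sqCentral
  rw [← mul_div_assoc, h2, pow_succ]
  field_simp
  ring

lemma sqCentral_mul_wallis (n : ℕ) : sqCentral n * (2 * n + 1) * Real.Wallis.W n = 1 := by
  induction n with
  | zero => simp [sqCentral_zero, Real.Wallis.W]
  | succ n ih =>
    rw [Real.Wallis.W_succ]
    have h := sqCentral_succ n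
    have hs : sqCentral (n + 1) = ((n : ℝ) + 1 / 2) ^ 2 * sqCentral n / ((n : ℝ) + 1) ^ 2 := by
      rw [← h]; field_simp
    rw [hs]
    refine Eq.trans ?_ ih
    push_cast
    field_simp
    ring

lemma tendsto_mul_sqCentral : Tendsto (fun n : ℕ => (n : ℝ) * sqCentral n) atTop (𝓝 (1 / π)) := by
  have hW : Tendsto (fun n : ℕ => (Real.Wallis.W n)⁻¹) atTop (𝓝 (π / 2)⁻¹) :=
    Real.tendsto_prod_pi_div_two.inv₀ (by positivity)
  have hq : Tendsto (fun n : ℕ => (n : ℝ) / (n + 1 / 2)) atTop (𝓝 1) :=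
    tendsto_natCast_div_add_atTop (1 / 2 : ℝ)
  have := (hW.mul hq).div_const 2
  refine (this.congr fun n => ?_).trans (by
    rw [show (π / 2)⁻¹ * 1 / 2 = 1 / π by field_simp])
  have h := sqCentral_mul_wallis n
  have hp := Real.Wallis.W_pos n
  rw [← eq_div_iff hp.ne', one_div] at h
  rw [← h]
  field_simp

lemma tendsto_sqCentral : Tendsto sqCentral atTop (𝓝 0) := by
  have h := tendsto_mul_sqCentral.mul (tendsto_inv_atTop_nhds_zero_nat (𝕜 := ℝ))
  rw [mul_zero] at h
  refine h.congr' ?_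
  filter_upwards [eventually_gt_atTop 0] with n hn
  have : (n : ℝ) ≠ 0 := by positivity
  field_simp

/-- The ratio `m!² / ((m - n)! (m + n)!)`, which vanishes for `n > m`. -/
noncomputable def factRatio (m n : ℕ) : ℝ := ∏ i ∈ range n, ((m : ℝ) - i) / (m + i + 1)

lemma factRatio_zero (m : ℕ) : factRatio m 0 = 1 := by simp [factRatio]

lemma factRatio_succ (m n : ℕ) :
    factRatio m (n + 1) = factRatio m n * (((m : ℝ) - n) / (m + n + 1)) :=
  prod_range_succ _ _

lemma factRatio_eq_zero {m n : ℕ} (h : m < n) : factRatio m n = 0 :=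
  prod_eq_zero (mem_range.2 h) (by simp)

lemma factRatio_nonneg (m n : ℕ) : 0 ≤ factRatio m n := by
  rcases lt_or_ge m n with h | h
  · rw [factRatio_eq_zero h]
  · refine prod_nonneg fun i hi => div_nonneg ?_ (by positivity)
    have : i ≤ m := by have := mem_range.1 hi; omega
    exact sub_nonneg.2 (by exact_mod_cast this)

lemma factRatio_succ_left (m n : ℕ) :
    factRatio (m + 1) n * ((m + 1 - n) * (m + 1 + n)) = ((m : ℝ) + 1) ^ 2 * factRatio m n := by
  induction n with
  | zero => simp [factRatio_zero]; ring
  | succ n ih =>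
    rw [factRatio_succ, factRatio_succ]
    push_cast
    field_simp
    linear_combination ((m : ℝ) - n) * ((m:ℝ) + 1 + 1 + n) * ih

lemma tendsto_factRatio (n : ℕ) : Tendsto (fun m => factRatio m n) atTop (𝓝 1) := by
  have h : ∀ i ∈ range n,
      Tendsto (fun m : ℕ => ((m : ℝ) - i) / (m + i + 1)) atTop (𝓝 1) := by
    intro i _
    have h1 : Tendsto (fun m : ℕ => (m : ℝ) + (i + 1)) atTop atTop :=
      tendsto_atTop_add_const_right _ _ tendsto_natCast_atTop_atTop
    have h2 : Tendsto (fun m : ℕ => 1 - (2 * (i : ℝ) + 1) / ((m : ℝ) + (i + 1))) atTop (𝓝 1) := by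
      simpa using (tendsto_const_nhds (x := (1 : ℝ))).sub (h1.const_div_atTop (2 * (i : ℝ) + 1))
    refine h2.congr fun m => ?_
    field_simp
    ring
  simpa [factRatio] using tendsto_finsetProd _ h

/-- The ratio `m!² / ((m - n)! (m + n + 1)!)`, the integral of `x ^ m` against the shifted
Legendre polynomial of degree `n` over `[0, 1]`. -/
noncomputable def legendreMoment (m n : ℕ) : ℝ := factRatio m n / (m + n + 1)

lemma legendreMoment_nonneg (m n : ℕ) : 0 ≤ legendreMoment m n :=
  div_nonneg (factRatio_nonneg m n) (by positivity)

lemma legendreMoment_eq_zero {m n : ℕ} (h : m < n) : legendreMoment m n = 0 := by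
  simp [legendreMoment, factRatio_eq_zero h]

lemma sum_odd_mul_legendreMoment (m : ℕ) :
    ∑ n ∈ range (m + 1), (2 * (n : ℝ) + 1) * legendreMoment m n = 1 := by
  have h : ∀ n : ℕ, (2 * (n : ℝ) + 1) * legendreMoment m n = factRatio m n - factRatio m (n + 1) := by
    intro n
    rw [factRatio_succ, legendreMoment]
    field_simp
    ring
  simp only [h]
  rw [sum_range_sub', factRatio_zero, factRatio_eq_zero (Nat.lt_succ_self m), sub_zero]

lemma sum_alternating_legendreMoment (m : ℕ) :
    ∑ n ∈ range (m + 1), (-1) ^ n * legendreMoment m n = 1 / (2 * m + 1) := by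
  have h : ∀ n : ℕ, (-1) ^ n * legendreMoment m n
      = ((-1) ^ n * factRatio m n - (-1) ^ (n + 1) * factRatio m (n + 1)) / (2 * m + 1) := by
    intro n
    rw [factRatio_succ, legendreMoment, pow_succ]
    field_simp
    ring
  simp only [h]
  rw [← sum_div, sum_range_sub' (fun n => (-1 : ℝ) ^ n * factRatio m n), factRatio_zero,
    factRatio_eq_zero (Nat.lt_succ_self m)]
  simp

lemma legendreMoment_succ_left (m n : ℕ) :
    ((m : ℝ) + 3 / 2) ^ 2 * legendreMoment (m + 1) n - (m + 1) ^ 2 * legendreMoment m n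
      = (n + 1 / 2) ^ 2 * legendreMoment (m + 1) n := by
  have h := factRatio_succ_left m n
  have hmoment : legendreMoment m n * (m + 1) ^ 2
      = factRatio (m + 1) n * (m + 1 - n) := by
    rw [legendreMoment]
    field_simp
    linear_combination -h
  have hratio : factRatio (m + 1) n = legendreMoment (m + 1) n * (m + n + 2) := by
    rw [legendreMoment]
    push_cast
    field_simp
    ring
  rw [hratio] at hmoment
  linear_combination -hmoment

/-- Partial sums of the squared normalised central binomial coefficients. -/
noncomputable def sqCentralSum (m : ℕ) : ℝ := ∑ j ∈ range (m + 1), sqCentral j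

lemma sqCentralSum_succ (m : ℕ) : sqCentralSum (m + 1) = sqCentralSum m + sqCentral (m + 1) :=
  sum_range_succ _ _

lemma sqCentralSum_eq (m : ℕ) :
    sqCentralSum m = (2 * m + 1) ^ 2 * sqCentral m *
      ∑ n ∈ range (m + 1), 1 / (2 * (n : ℝ) + 1) * legendreMoment m n := by
  induction m with
  | zero => simp [sqCentralSum, sqCentral_zero, legendreMoment, factRatio_zero]
  | succ m ih =>
    have hstep : ((m : ℝ) + 3 / 2) ^ 2 *
          ∑ n ∈ range (m + 1 + 1), 1 / (2 * (n : ℝ) + 1) * legendreMoment (m + 1) n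
        - (m + 1) ^ 2 * ∑ n ∈ range (m + 1), 1 / (2 * (n : ℝ) + 1) * legendreMoment m n
        = 1 / 4 := by
      have hext : ∑ n ∈ range (m + 1), 1 / (2 * (n : ℝ) + 1) * legendreMoment m n
          = ∑ n ∈ range (m + 1 + 1), 1 / (2 * (n : ℝ) + 1) * legendreMoment m n := by
        rw [sum_range_succ _ (m + 1), legendreMoment_eq_zero (Nat.lt_succ_self m)]
        simp
      rw [hext, mul_sum, mul_sum, ← sum_sub_distrib,
        show (1 / 4 : ℝ) = (∑ n ∈ range (m + 1 + 1), (2 * (n : ℝ) + 1) * legendreMoment (m + 1) n) / 4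
          by rw [sum_odd_mul_legendreMoment], sum_div]
      refine sum_congr rfl fun n _ => ?_
      have h := legendreMoment_succ_left m n
      field_simp
      linear_combination 16 * h
    have hs := sqCentral_succ m
    rw [sqCentralSum_succ, ih]
    push_cast
    linear_combination (4 * sqCentral (m + 1)) * (-hstep) +
      (-4 * ∑ n ∈ range (m + 1), 1 / (2 * (n : ℝ) + 1) * legendreMoment m n) * hs

lemma hasSum_sqCentral_mul_legendreMoment (n : ℕ) :
    HasSum (fun m => sqCentral m * legendreMoment m n) (4 / (π * (2 * n + 1) ^ 2)) := by
  rw [hasSum_iff_tendsto_nat_of_nonneg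
    (fun m => mul_nonneg (sqCentral_pos m).le (legendreMoment_nonneg m n))]
  have hsum : ∀ N : ℕ, ∑ m ∈ range N, sqCentral m * legendreMoment m n
      = 4 / (2 * n + 1) ^ 2 * (sqCentral N * (N - n) * factRatio N n) := by
    intro N
    induction N with
    | zero =>
      rcases Nat.eq_zero_or_pos n with h | h
      · simp [h]
      · simp [factRatio_eq_zero h]
    | succ N ih =>
      rw [sum_range_succ, ih, legendreMoment]
      have h1 := sqCentral_succ N
      have h2 := factRatio_succ_left N n
      have h3 : sqCentral (N + 1) * ((N : ℝ) + 1 - n) * factRatio (N + 1) n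
          = (N + 1 / 2) ^ 2 * sqCentral N * factRatio N n / (N + n + 1) := by
        field_simp
        linear_combination 4 * sqCentral (N + 1) * h2 + 4 * factRatio N n * h1
      push_cast
      rw [h3]
      field_simp
      ring
  simp only [hsum]
  have h1 := tendsto_mul_sqCentral.sub (tendsto_sqCentral.const_mul (n : ℝ))
  have h2 := (h1.mul (tendsto_factRatio n)).const_mul (4 / (2 * (n : ℝ) + 1) ^ 2)
  convert h2 using 2
  · ring
  · field_simp
    ring

lemma summable_inv_odd_sq : Summable fun n : ℕ => 1 / (2 * (n : ℝ) + 1) ^ 2 := by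
  have h : Summable fun n : ℕ => 1 / ((n : ℝ) + 1) ^ 2 := by
    exact_mod_cast (summable_nat_add_iff 1).2 (Real.summable_one_div_nat_pow.2 one_lt_two)
  refine h.of_nonneg_of_le (fun n => by positivity) fun n => ?_
  gcongr
  linarith [(Nat.cast_nonneg n : (0 : ℝ) ≤ n)]

/-- Exchange of summation for a bounded sequence of weights. -/
lemma hasSum_sqCentral_mul_sum {c : ℕ → ℝ} (hc : ∀ n, |c n| ≤ 1) :
    HasSum (fun m => sqCentral m * ∑ n ∈ range (m + 1), c n * legendreMoment m n)
      (4 / π * ∑' n : ℕ, c n / (2 * n + 1) ^ 2) := by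
  have hnn : ∀ p : ℕ × ℕ, 0 ≤ sqCentral p.2 * legendreMoment p.2 p.1 := fun p =>
    mul_nonneg (sqCentral_pos _).le (legendreMoment_nonneg _ _)
  have hpos : Summable fun p : ℕ × ℕ => sqCentral p.2 * legendreMoment p.2 p.1 := by
    rw [summable_prod_of_nonneg hnn]
    refine ⟨fun n => (hasSum_sqCentral_mul_legendreMoment n).summable, ?_⟩
    simp only [(hasSum_sqCentral_mul_legendreMoment _).tsum_eq]
    refine (summable_inv_odd_sq.mul_left (4 / π)).congr fun n => ?_
    field_simp
  have hsum : Summable fun p : ℕ × ℕ => c p.1 * (sqCentral p.2 * legendreMoment p.2 p.1) := by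
    refine hpos.of_norm_bounded fun p => ?_
    rw [norm_mul, Real.norm_of_nonneg (hnn p)]
    exact mul_le_of_le_one_left (hnn p) (hc p.1)
  have hcol := hsum.hasSum.prod_fiberwise
    (fun n => (hasSum_sqCentral_mul_legendreMoment n).mul_left (c n))
  have hrow := ((Equiv.prodComm ℕ ℕ).hasSum_iff.2 hsum.hasSum).prod_fiberwise
    (g := fun m => sqCentral m * ∑ n ∈ range (m + 1), c n * legendreMoment m n) (fun m => by
      rw [mul_sum]
      have : ∀ n ∉ range (m + 1), c n * (sqCentral m * legendreMoment m n) = 0 := fun n hn => by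
        rw [legendreMoment_eq_zero (by simpa using hn)]
        simp
      have hfin : HasSum (fun n => c n * (sqCentral m * legendreMoment m n)) _ :=
        hasSum_sum_of_ne_finset_zero this
      convert hfin using 1
      · rfl
      exact sum_congr rfl fun n _ => by ring)
  rw [← hcol.tsum_eq] at hrow
  convert hrow using 1
  rw [← tsum_mul_left]
  exact tsum_congr fun n => by field_simp

lemma hasSum_sqCentralSum_div_sq :
    HasSum (fun m : ℕ => sqCentralSum m / (2 * m + 1) ^ 2)
      (4 / π * ∑' n : ℕ, 1 / (2 * (n : ℝ) + 1) ^ 3) := by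
  have hc : ∀ n : ℕ, |1 / (2 * (n : ℝ) + 1)| ≤ 1 := fun n => by
    rw [abs_of_nonneg (by positivity), div_le_one (by positivity)]
    linarith [(Nat.cast_nonneg n : (0 : ℝ) ≤ n)]
  convert hasSum_sqCentral_mul_sum hc using 1
  · ext m
    rw [sqCentralSum_eq]
    field_simp
  · congr 1
    exact tsum_congr fun n => by field_simp

lemma hasSum_sqCentral_div_odd :
    HasSum (fun m : ℕ => sqCentral m / (2 * m + 1)) (4 / π * catalanG) := by
  have hc : ∀ n : ℕ, |(-1 : ℝ) ^ n| ≤ 1 := fun n => by simp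
  rw [catalanG]
  convert hasSum_sqCentral_mul_sum hc using 1
  ext m
  rw [sum_alternating_legendreMoment]
  ring

lemma hasSum_sqCentralSum_div_mul :
    HasSum (fun m : ℕ => sqCentralSum m / ((2 * m + 1) * (2 * m + 3))) (2 / π * catalanG) := by
  have hnn : ∀ m, 0 ≤ sqCentralSum m := fun m => sum_nonneg fun j _ => (sqCentral_pos j).le
  rw [hasSum_iff_tendsto_nat_of_nonneg (fun m => div_nonneg (hnn m) (by positivity))]
  have hsum : ∀ N : ℕ, ∑ m ∈ range N, sqCentralSum m / ((2 * (m : ℝ) + 1) * (2 * m + 3))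
      = 1 / 2 * (∑ m ∈ range (N + 1), sqCentral m / (2 * m + 1) - sqCentralSum N / (2 * N + 1)) := by
    intro N
    induction N with
    | zero => simp [sqCentralSum]
    | succ N ih =>
      rw [sum_range_succ, ih, sum_range_succ _ (N + 1), sqCentralSum_succ]
      push_cast
      field_simp
      ring
  simp only [hsum]
  have h1 := (tendsto_add_atTop_iff_nat 1).2 hasSum_sqCentral_div_odd.tendsto_sum_nat
  have h2 : Tendsto (fun N : ℕ => sqCentralSum N / (2 * N + 1)) atTop (𝓝 0) := by
    have := (tendsto_add_atTop_iff_nat 1).2 tendsto_sqCentral.cesaro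
    refine squeeze_zero (fun N => div_nonneg (hnn N) (by positivity)) (fun N => ?_) this
    rw [← sqCentralSum, div_eq_inv_mul]
    refine mul_le_mul_of_nonneg_right ?_ (hnn N)
    push_cast
    gcongr
    linarith [(Nat.cast_nonneg N : (0 : ℝ) ≤ N)]
  convert (h1.sub h2).const_mul (1 / 2) using 2
  ring

lemma summable_sqCentral_div (m : ℕ) :
    Summable fun n : ℕ => sqCentral n / ((m : ℝ) + n + 1) := by
  refine (hasSum_sqCentral_mul_legendreMoment 0).summable.of_nonneg_of_le
    (fun n => div_nonneg (sqCentral_pos n).le (by positivity)) fun n => ?_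
  rw [legendreMoment, factRatio_zero, mul_one_div]
  refine div_le_div_of_nonneg_left (sqCentral_pos n).le (by positivity) ?_
  push_cast
  linarith [(Nat.cast_nonneg m : (0 : ℝ) ≤ m)]

lemma tsum_sqCentral_div_succ (m : ℕ) :
    ((m : ℝ) + 3 / 2) ^ 2 * ∑' n : ℕ, sqCentral n / (((m + 1 : ℕ) : ℝ) + n + 1)
      - ((m : ℝ) + 1) ^ 2 * ∑' n : ℕ, sqCentral n / ((m : ℝ) + n + 1) = 1 / π := by
  have h := (((summable_sqCentral_div (m + 1)).hasSum.mul_left (((m : ℝ) + 3 / 2) ^ 2)).sub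
    ((summable_sqCentral_div m).hasSum.mul_left (((m : ℝ) + 1) ^ 2))).tendsto_sum_nat
  refine tendsto_nhds_unique h ?_
  have hsum : ∀ N : ℕ, ∑ n ∈ range N,
      (((m : ℝ) + 3 / 2) ^ 2 * (sqCentral n / (((m + 1 : ℕ) : ℝ) + n + 1))
        - ((m : ℝ) + 1) ^ 2 * (sqCentral n / ((m : ℝ) + n + 1)))
      = N * sqCentral N * (N / (N + (m + 1))) := by
    intro N
    induction N with
    | zero => simp
    | succ N ih =>
      have hs : sqCentral (N + 1) = ((N : ℝ) + 1 / 2) ^ 2 * sqCentral N / ((N : ℝ) + 1) ^ 2 := by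
        rw [← sqCentral_succ]; field_simp
      rw [sum_range_succ, ih, hs]
      push_cast
      field_simp
      ring
  simp only [hsum]
  simpa using tendsto_mul_sqCentral.mul (tendsto_natCast_div_add_atTop ((m : ℝ) + 1))

lemma sqCentral_mul_tsum (m : ℕ) :
    sqCentral m * ∑' n : ℕ, sqCentral n / ((m : ℝ) + n + 1)
      = 4 / π * (sqCentralSum m / (2 * m + 1) ^ 2) := by
  induction m with
  | zero =>
    have h := (hasSum_sqCentral_mul_legendreMoment 0).tsum_eq
    simp only [legendreMoment, factRatio_zero, mul_one_div] at h
    simp only [sqCentral_zero, sqCentralSum]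
    simpa [sqCentral_zero] using h
  | succ m ih =>
    have h := tsum_sqCentral_div_succ m
    have hs := sqCentral_succ m
    rw [sqCentralSum_succ]
    set X := ∑' n : ℕ, sqCentral n / (((m + 1 : ℕ) : ℝ) + n + 1)
    set Y := ∑' n : ℕ, sqCentral n / ((m : ℝ) + n + 1)
    have ih_scaled : ((m : ℝ) + 1 / 2) ^ 2 * sqCentral m * Y = sqCentralSum m / π := by
      rw [mul_assoc, ih]
      field_simp
      ring
    have key : ((m : ℝ) + 3 / 2) ^ 2 * (sqCentral (m + 1) * X)
        = (sqCentralSum m + sqCentral (m + 1)) / π := by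
      rw [add_div, ← ih_scaled]
      linear_combination sqCentral (m + 1) * h + Y * hs
    have hne : ((m : ℝ) + 3 / 2) ^ 2 ≠ 0 := by positivity
    apply mul_left_cancel₀ hne
    rw [key]
    push_cast
    field_simp
    ring

lemma tsum_inv_odd_cube : ∑' n : ℕ, 1 / (2 * (n : ℝ) + 1) ^ 3 = 7 / 8 * zeta3 := by
  have hs : Summable fun k : ℕ => 1 / ((k : ℝ) + 1) ^ 3 := by
    exact_mod_cast (summable_nat_add_iff 1).2 (Real.summable_one_div_nat_pow.2 (by norm_num : 1 < 3))
  have h := tsum_even_add_odd (f := fun k : ℕ => 1 / ((k : ℝ) + 1) ^ 3)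
    (hs.comp_injective fun a b h => by simpa using h)
    (hs.comp_injective fun a b h => by simpa using h)
  have hodd : ∑' k : ℕ, 1 / (((2 * k + 1 : ℕ) : ℝ) + 1) ^ 3 = 1 / 8 * zeta3 := by
    rw [zeta3, ← tsum_mul_left]
    refine tsum_congr fun k => ?_
    push_cast
    field_simp
    ring
  rw [hodd, ← zeta3] at h
  push_cast at h
  linarith

theorem double_series_central_binoms :
    ∑' m : ℕ, ∑' n : ℕ,
        ((2*m).choose m : ℝ)^2 * ((2*n).choose n : ℝ)^2 /
          (16 ^ (m + n) * ((m:ℝ) + (n:ℝ) + 1) * (2 * (m:ℝ) + 3))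
      = (7 * zeta3 - 4 * catalanG) / π^2 := by
  have hinner : ∀ m : ℕ, ∑' n : ℕ,
        ((2*m).choose m : ℝ)^2 * ((2*n).choose n : ℝ)^2 /
          (16 ^ (m + n) * ((m:ℝ) + (n:ℝ) + 1) * (2 * (m:ℝ) + 3))
      = 2 / π * (sqCentralSum m / (2 * m + 1) ^ 2
          - sqCentralSum m / ((2 * m + 1) * (2 * m + 3))) := by
    intro m
    have hterm : ∀ n : ℕ, ((2*m).choose m : ℝ)^2 * ((2*n).choose n : ℝ)^2 /
          (16 ^ (m + n) * ((m:ℝ) + (n:ℝ) + 1) * (2 * (m:ℝ) + 3))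
        = sqCentral m / (2 * m + 3) * (sqCentral n / ((m : ℝ) + n + 1)) := by
      intro n
      rw [sqCentral, sqCentral, pow_add]
      field_simp
    simp only [hterm]
    rw [tsum_mul_left, div_mul_eq_mul_div, sqCentral_mul_tsum]
    field_simp
    ring
  simp only [hinner]
  rw [((hasSum_sqCentralSum_div_sq.sub hasSum_sqCentralSum_div_mul).mul_left (2 / π)).tsum_eq,
    tsum_inv_odd_cube]
  field_simp
  ring
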